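/- Let u ∈ 𝒦 with corresponding closed set E ⊂ (−∞,0]. Then r ↦ u(r)/r^{1/2} = B(r,u)/r^{1/2} is decreasing for r > 0; in particular the order of u is at most 1/2. -/

import Mathlib

open Filter Metric Real MeasureTheory

/-- The sub-mean-value property on circles; with continuity this expresses
that `u` is subharmonic in `ℂ`. -/
def Submean (u : ℂ → ℝ) : Prop :=
  ∀ (z : ℂ) (ρ : ℝ), 0 < ρ →
    u z ≤ (1 / (2 * π)) * ∫ θ in (0:ℝ)..(2 * π), u (z + ρ * Complex.exp (θ * Complex.I))

/-- Mean-value equality on all circles whose closed discs lie in `D`; this expresses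
that `u` is harmonic on `D`. -/
def HarmonicMeanOn (u : ℂ → ℝ) (D : Set ℂ) : Prop :=
  ∀ z ∈ D, ∀ ρ : ℝ, 0 < ρ → closedBall z ρ ⊆ D →
    u z = (1 / (2 * π)) * ∫ θ in (0:ℝ)..(2 * π), u (z + ρ * Complex.exp (θ * Complex.I))

/-- `B(r,u) = max_{|z|=r} u(z)`. -/
noncomputable def Bmax (u : ℂ → ℝ) (r : ℝ) : ℝ := sSup (u '' sphere (0 : ℂ) r)

/-- `A(r,u) = min_{|z|=r} u(z)`. -/
noncomputable def Amin (u : ℂ → ℝ) (r : ℝ) : ℝ := sInf (u '' sphere (0 : ℂ) r)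

/-- The class `𝒦`: `u` is continuous and subharmonic in `ℂ`, positive and harmonic
in `ℂ \ E`, where `E ⊆ (-∞, 0]` is a closed set on which `u` vanishes; `u` is
symmetric in the real axis. -/
structure ClassK (u : ℂ → ℝ) (E : Set ℂ) : Prop where
  closed : IsClosed E
  subNegAxis : E ⊆ {z : ℂ | z.im = 0 ∧ z.re ≤ 0}
  cont : Continuous u
  submean : Submean u
  vanish : ∀ z ∈ E, u z = 0
  pos : ∀ z ∉ E, 0 < u z
  harm : HarmonicMeanOn u Eᶜ
  symm : ∀ z : ℂ, u ((starRingEnd ℂ) z) = u z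

theorem circleAverage_norm_sq (a : ℂ) (ρ : ℝ) :
    circleAverage (fun z ↦ ‖z‖ ^ 2) a ρ = ‖a‖ ^ 2 + ρ ^ 2 := by
  have hp : ∀ z ∈ sphere a |ρ|, ‖z‖ ^ 2 =
      (‖a‖ ^ 2 + ρ ^ 2) + (2 * (starRingEnd ℂ) a * (z - a)).re := by
    intro z hz
    have h1 : ‖z - a‖ ^ 2 = ρ ^ 2 := by
      rw [mem_sphere_iff_norm.1 hz, sq_abs]
    rw [← h1]
    simp only [Complex.sq_norm, Complex.normSq_apply, Complex.sub_re, Complex.sub_im,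
      Complex.mul_re, Complex.mul_im, Complex.conj_re, Complex.conj_im, Complex.re_ofNat,
      Complex.im_ofNat]
    ring
  rw [circleAverage_congr_sphere hp, circleAverage_fun_add (circleIntegrable_const _ _ _)
    (by apply ContinuousOn.circleIntegrable'; fun_prop), circleAverage_const]
  have : circleAverage (fun z : ℂ ↦ (2 * (starRingEnd ℂ) a * (z - a)).re) a ρ = 0 := by
    have := InnerProductSpace.HarmonicOnNhd.circleAverage_eq
      (f := fun z : ℂ ↦ (2 * (starRingEnd ℂ) a * (z - a)).re) (c := a) (R := ρ)
      (fun z _ ↦ AnalyticAt.harmonicAt_re (by fun_prop))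
    simpa using this
  rw [this, add_zero]

/-- The maximum principle for continuous functions satisfying the sub-mean-value inequality. -/
theorem le_of_le_circleAverage_of_le_sphere {f : ℂ → ℝ} {R M : ℝ}
    (hf : ContinuousOn f (closedBall 0 R))
    (hm : ∀ z : ℂ, ∀ ρ > 0, closedBall z ρ ⊆ closedBall 0 R → f z ≤ circleAverage f z ρ)
    (hb : ∀ z ∈ sphere (0 : ℂ) R, f z ≤ M) {z : ℂ} (hz : z ∈ closedBall 0 R) : f z ≤ M := by
  have key : ∀ δ > 0, f z ≤ M + δ * R ^ 2 := by
    intro δ hδ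
    have hc : ContinuousOn (fun z ↦ f z + δ * ‖z‖ ^ 2) (closedBall 0 R) := by fun_prop
    obtain ⟨a, ha, hmax⟩ := (isCompact_closedBall (0 : ℂ) R).exists_isMaxOn ⟨z, hz⟩ hc
    have h1 : f z + δ * ‖z‖ ^ 2 ≤ f a + δ * ‖a‖ ^ 2 := hmax hz
    have h2 : 0 ≤ δ * ‖z‖ ^ 2 := by positivity
    have haR : ‖a‖ ≤ R := by simpa using ha
    rcases haR.eq_or_lt with h | h
    · have := hb a (by simpa using h)
      rw [h] at h1
      linarith
    · exfalso
      have hsub : closedBall a (R - ‖a‖) ⊆ closedBall 0 R := by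
        apply closedBall_subset_closedBall'
        simp
      have hρ : 0 < R - ‖a‖ := by linarith
      have hsp : sphere a |R - ‖a‖| ⊆ closedBall 0 R := by
        rw [abs_of_pos hρ]; exact sphere_subset_closedBall.trans hsub
      have hi : CircleIntegrable f a (R - ‖a‖) := (hf.mono hsp).circleIntegrable'
      have hi2 : CircleIntegrable (fun z ↦ δ * ‖z‖ ^ 2) a (R - ‖a‖) := by
        apply ContinuousOn.circleIntegrable'; fun_prop
      have h3 := circleAverage_mono_on_of_le_circle (f := fun z ↦ f z + δ * ‖z‖ ^ 2)
        (hi.add hi2) (fun x hx ↦ hmax (hsp hx))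
      rw [circleAverage_fun_add hi hi2] at h3
      have h4 := circleAverage_fun_smul (𝕜 := ℝ) (a := δ) (f := fun z : ℂ ↦ ‖z‖ ^ 2) (c := a)
        (R := R - ‖a‖)
      simp only [smul_eq_mul] at h4
      rw [h4, circleAverage_norm_sq] at h3
      have h5 := hm a _ hρ hsub
      have : 0 < δ * (R - ‖a‖) ^ 2 := by positivity
      simp only at h3
      linarith
  by_contra! hlt
  have hR : 0 ≤ R := nonneg_of_mem_closedBall hz
  have h := key ((f z - M) / (2 * (R ^ 2 + 1))) (by
    apply div_pos <;> [linarith; positivity])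
  have : (f z - M) / (2 * (R ^ 2 + 1)) * R ^ 2 ≤ (f z - M) / 2 := by
    rw [div_mul_eq_mul_div, div_le_div_iff₀ (by positivity) (by norm_num)]
    nlinarith [sq_nonneg R]
  linarith

theorem exists_re_approx {f : ℂ → ℝ} {R ε : ℝ} (hR : 0 < R) (hε : 0 < ε)
    (hf : ContinuousOn f (sphere 0 R)) :
    ∃ p : ℂ → ℂ, Differentiable ℂ p ∧ ∀ z ∈ sphere (0 : ℂ) R, |f z - (p z).re| ≤ ε := by
  let : Fact (0 < 2 * π) := ⟨two_pi_pos⟩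
  have hspan : ∀ h ∈ Submodule.span ℂ (Set.range (@fourier (2 * π))), ∀ c : ℂ,
      ∃ p : ℂ → ℂ, Differentiable ℂ p ∧
        ∀ t : AddCircle (2 * π), (c * h t).re = (p (R * AddCircle.toCircle t)).re := by
    intro h hh
    induction hh using Submodule.span_induction with
    | mem x hx =>
      obtain ⟨n, rfl⟩ := hx
      intro c
      have hR' : (R : ℂ) ≠ 0 := by exact_mod_cast hR.ne'
      obtain ⟨k, rfl | rfl⟩ := n.eq_nat_or_neg
      · refine ⟨fun z ↦ c * (z / R) ^ k, by fun_prop, fun t ↦ ?_⟩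
        simp [fourier_apply, AddCircle.toCircle_nsmul, hR']
      · refine ⟨fun z ↦ (starRingEnd ℂ) c * (z / R) ^ k, by fun_prop, fun t ↦ ?_⟩
        rw [fourier_neg, ← Complex.conj_re]
        simp [fourier_apply, AddCircle.toCircle_nsmul, hR']
    | zero => exact fun c ↦ ⟨0, by fun_prop, by simp⟩
    | add x y _ _ hx hy =>
      intro c
      obtain ⟨p, hp, hp'⟩ := hx c
      obtain ⟨q, hq, hq'⟩ := hy c
      exact ⟨p + q, hp.add hq, fun t ↦ by simp [mul_add, ← hp', ← hq']⟩
    | smul a x _ hx =>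
      intro c
      obtain ⟨p, hp, hp'⟩ := hx (c * a)
      exact ⟨p, hp, fun t ↦ by simp [← hp', mul_assoc]⟩
  have hmem : ∀ t : AddCircle (2 * π), (R * AddCircle.toCircle t : ℂ) ∈ sphere (0 : ℂ) R := by
    intro t; simp [hR.le, Circle.norm_coe]
  let F : C(AddCircle (2 * π), ℂ) := ⟨fun t ↦ (f (R * AddCircle.toCircle t) : ℂ), by
    refine Complex.continuous_ofReal.comp (hf.comp_continuous ?_ hmem)
    exact continuous_const.mul (continuous_subtype_val.comp AddCircle.continuous_toCircle)⟩
  have hF : F ∈ (Submodule.span ℂ (Set.range (@fourier (2 * π)))).topologicalClosure := by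
    rw [span_fourier_closure_eq_top]; trivial
  obtain ⟨h, hh, hd⟩ := Metric.mem_closure_iff.1 hF ε hε
  obtain ⟨p, hp, hp'⟩ := hspan h hh 1
  refine ⟨p, hp, fun z hz ↦ ?_⟩
  obtain ⟨t, rfl⟩ : ∃ t : AddCircle (2 * π), (R * AddCircle.toCircle t : ℂ) = z := by
    obtain ⟨θ, -, hθ⟩ : z ∈ circleMap 0 R '' Set.Ioc 0 (2 * π) := by
      rw [image_circleMap_Ioc, abs_of_pos hR]; exact hz
    refine ⟨(θ : AddCircle (2 * π)), ?_⟩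
    rw [← hθ, circleMap_zero, AddCircle.toCircle_apply_mk]
    simp
  have h1 := (ContinuousMap.dist_apply_le_dist (f := F) (g := h) t).trans hd.le
  rw [← hp', one_mul]
  rw [dist_eq_norm] at h1
  exact (by simpa [F] using Complex.abs_re_le_norm (F t - h t) : _ ≤ _).trans h1

/-- A continuous function with the mean value property on a disc is the real part of an analytic
function there. -/
theorem exists_analyticOnNhd_re_eq_of_circleAverage_eq {f : ℂ → ℝ} {R : ℝ} (hR : 0 < R)
    (hf : ContinuousOn f (closedBall 0 R))
    (hm : ∀ z : ℂ, ∀ ρ > 0, closedBall z ρ ⊆ closedBall 0 R → f z = circleAverage f z ρ) :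
    ∃ G : ℂ → ℂ, AnalyticOnNhd ℂ G (ball 0 R) ∧ ∀ w ∈ ball (0 : ℂ) R, f w = (G w).re := by
  have hsR : sphere (0 : ℂ) |R| ⊆ closedBall 0 R := by
    rw [abs_of_pos hR]; exact sphere_subset_closedBall
  have hi : CircleIntegrable f 0 R := (hf.mono hsR).circleIntegrable'
  refine ⟨fun w ↦ circleAverage (fun ζ ↦ herglotzRieszKernel 0 w ζ • (f ζ : ℂ)) 0 R, ?_, ?_⟩
  · refine analyticOnNhd_circleAverage_herglotzRieszKernel_smul ?_
    exact (Complex.continuous_ofReal.comp_continuousOn (hf.mono hsR)).circleIntegrable'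
  intro w hw
  rw [re_circleAverage_herglotzRieszKernel_smul hi hw]
  have hwR : ‖w‖ < R := by simpa using hw
  set C := (R + ‖w‖) / (R - ‖w‖) with hC
  have hC0 : 0 ≤ C := div_nonneg (by positivity) (by linarith)
  have key : ∀ ε > 0, |f w - circleAverage ((Complex.re ∘ herglotzRieszKernel 0 w) • f) 0 R| ≤
      ε * (1 + C) := by
    intro ε hε
    obtain ⟨p, hp, hpf⟩ := exists_re_approx hR hε (hf.mono sphere_subset_closedBall)
    have hharm : ∀ z, InnerProductSpace.HarmonicAt (fun z ↦ (p z).re) z :=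
      fun z ↦ (hp.analyticAt z).harmonicAt_re
    have hpc : Continuous fun z ↦ (p z).re := Complex.continuous_re.comp hp.continuous
    have hpm : ∀ z ρ, circleAverage (fun z ↦ (p z).re) z ρ = (p z).re :=
      fun z ρ ↦ InnerProductSpace.HarmonicOnNhd.circleAverage_eq fun z _ ↦ hharm z
    have hpi : ∀ z ρ, CircleIntegrable (fun z ↦ (p z).re) z ρ :=
      fun z ρ ↦ hpc.continuousOn.circleIntegrable'
    have hfi : ∀ z ρ, 0 < ρ → closedBall z ρ ⊆ closedBall 0 R → CircleIntegrable f z ρ := by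
      intro z ρ hρ hsub
      refine (hf.mono ?_).circleIntegrable'
      rw [abs_of_pos hρ]; exact sphere_subset_closedBall.trans hsub
    have h1 : f w - (p w).re ≤ ε := by
      refine le_of_le_circleAverage_of_le_sphere (f := fun z ↦ f z - (p z).re)
        (hf.sub hpc.continuousOn) (fun z ρ hρ hsub ↦ ?_)
        (fun z hz ↦ (abs_le.1 (hpf z hz)).2) (ball_subset_closedBall hw)
      rw [circleAverage_fun_sub (hfi z ρ hρ hsub) (hpi z ρ), hpm, ← hm z ρ hρ hsub]
    have h2 : (p w).re - f w ≤ ε := by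
      refine le_of_le_circleAverage_of_le_sphere (f := fun z ↦ (p z).re - f z)
        (hpc.continuousOn.sub hf) (fun z ρ hρ hsub ↦ ?_)
        (fun z hz ↦ by linarith [(abs_le.1 (hpf z hz)).1]) (ball_subset_closedBall hw)
      rw [circleAverage_fun_sub (hpi z ρ) (hfi z ρ hρ hsub), hpm, ← hm z ρ hρ hsub]
    have h3 := InnerProductSpace.HarmonicOnNhd.circleAverage_re_herglotzRieszKernel_smul
      (f := fun z ↦ (p z).re) (c := 0) (R := R) (w := w) (fun z _ ↦ hharm z) hw
    have hk : ContinuousOn (Complex.re ∘ herglotzRieszKernel 0 w) (sphere 0 |R|) :=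
      Complex.continuous_re.comp_continuousOn (continuousOn_herglotzRieszKernel_sphere hw)
    have hkb : ∀ z ∈ sphere (0 : ℂ) |R|, |(herglotzRieszKernel 0 w z).re| ≤ C := by
      intro z hz
      rw [abs_of_pos hR] at hz
      have hu := re_herglotzRieszKernel_le hz hw
      have hl := le_re_herglotzRieszKernel hz hw
      rw [herglotzRieszKernel_def, abs_of_nonneg]
      · simpa [hC] using hu
      · exact le_trans (div_nonneg (by simpa using hwR.le) (by positivity)) hl
    have h4 : |circleAverage ((Complex.re ∘ herglotzRieszKernel 0 w) • fun z ↦ (p z).re) 0 R -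
        circleAverage ((Complex.re ∘ herglotzRieszKernel 0 w) • f) 0 R| ≤ ε * C := by
      rw [← circleAverage_sub (hk.smul hpc.continuousOn).circleIntegrable'
        (hk.smul (hf.mono hsR)).circleIntegrable']
      refine abs_circleAverage_le_circleAverage_abs.trans
        (circleAverage_mono_on_of_le_circle ?_ fun z hz ↦ ?_)
      · exact (((hk.smul hpc.continuousOn).sub (hk.smul (hf.mono hsR))).abs).circleIntegrable'
      · have e1 := hkb z hz
        have e2 := hpf z (by rwa [abs_of_pos hR] at hz)
        simp only [Pi.abs_apply, Pi.sub_apply, Pi.mul_apply, Function.comp_apply, smul_eq_mul]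
        rw [← mul_sub, abs_mul, abs_sub_comm, mul_comm]
        exact mul_le_mul e2 e1 (abs_nonneg _) hε.le
    rw [h3] at h4
    rw [abs_le] at h4 ⊢
    constructor <;> linarith [h4.1, h4.2]
  rw [← sub_eq_zero, ← abs_nonpos_iff]
  refine le_of_forall_pos_le_add fun ε hε ↦ ?_
  have := key (ε / (1 + C)) (by positivity)
  rwa [div_mul_cancel₀ _ (by positivity), ← zero_add ε] at this

/-- **Harnack's inequality** on the unit disc. -/
theorem harnack_unitDisc {g : ℂ → ℝ} (hg : InnerProductSpace.HarmonicOnNhd g (ball 0 1))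
    (hpos : ∀ z ∈ ball (0 : ℂ) 1, 0 ≤ g z) {w : ℂ} (hw : ‖w‖ < 1) :
    g w ≤ g 0 * ((1 + ‖w‖) / (1 - ‖w‖)) := by
  have key : ∀ R ∈ Set.Ioo ‖w‖ 1, g w ≤ g 0 * ((R + ‖w‖) / (R - ‖w‖)) := by
    rintro R ⟨hwR, hR1⟩
    have hR : 0 < R := (norm_nonneg w).trans_lt hwR
    have hwb : w ∈ ball (0 : ℂ) R := by simpa using hwR
    have hsub : closedBall (0 : ℂ) R ⊆ ball 0 1 := closedBall_subset_ball hR1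
    have hsub' : sphere (0 : ℂ) |R| ⊆ ball 0 1 := by
      rw [abs_of_pos hR]; exact sphere_subset_closedBall.trans hsub
    have hgR : InnerProductSpace.HarmonicOnNhd g (closedBall 0 R) := fun z hz ↦ hg z (hsub hz)
    have hgc : ContinuousOn g (sphere 0 |R|) := hg.continuousOn.mono hsub'
    have hmean : circleAverage g 0 R = g 0 :=
      InnerProductSpace.HarmonicOnNhd.circleAverage_eq (by rwa [abs_of_pos hR])
    have hk : ContinuousOn (Complex.re ∘ herglotzRieszKernel 0 w) (sphere 0 |R|) :=
      Complex.continuous_re.comp_continuousOn (continuousOn_herglotzRieszKernel_sphere hwb)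
    rw [← InnerProductSpace.HarmonicOnNhd.circleAverage_re_herglotzRieszKernel_smul hgR hwb,
      ← hmean, mul_comm, ← smul_eq_mul, ← circleAverage_smul]
    refine circleAverage_mono (hk.smul hgc).circleIntegrable'
      (hgc.const_smul _).circleIntegrable' fun z hz ↦ ?_
    have hz' : z ∈ sphere (0 : ℂ) R := by rwa [abs_of_pos hR] at hz
    have hu := re_herglotzRieszKernel_le hz' hwb
    simp only [Pi.smul_apply', Pi.smul_apply, Function.comp_apply, smul_eq_mul,
      herglotzRieszKernel_def]
    refine mul_le_mul_of_nonneg_right (by simpa using hu) (hpos z (hsub' hz))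
  have hlim : Tendsto (fun R ↦ g 0 * ((R + ‖w‖) / (R - ‖w‖))) (nhdsWithin 1 (Set.Iio 1))
      (nhds (g 0 * ((1 + ‖w‖) / (1 - ‖w‖)))) := by
    refine Tendsto.mono_left ?_ nhdsWithin_le_nhds
    have : (1 : ℝ) - ‖w‖ ≠ 0 := by linarith
    exact ContinuousAt.tendsto (f := fun R : ℝ ↦ g 0 * ((R + ‖w‖) / (R - ‖w‖)))
      (by fun_prop (disch := assumption))
  refine ge_of_tendsto hlim ?_
  filter_upwards [Ioo_mem_nhdsLT hw] with R hR using key R hR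

theorem ClassK.harmonicAt_comp {u : ℂ → ℝ} {E : Set ℂ} (hK : ClassK u E) {F : ℂ → ℂ} {ζ : ℂ}
    (hF : AnalyticAt ℂ F ζ) (hζ : F ζ ∉ E) :
    InnerProductSpace.HarmonicAt (fun x ↦ u (F x)) ζ := by
  obtain ⟨R, hR, hRE⟩ := nhds_basis_closedBall.mem_iff.1 (hK.closed.isOpen_compl.mem_nhds hζ)
  obtain ⟨G, hG, hGu⟩ := exists_analyticOnNhd_re_eq_of_circleAverage_eq
    (f := fun z ↦ u (F ζ + z)) hR (hK.cont.comp (by fun_prop)).continuousOn (by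
      intro z ρ hρ hsub
      have hsub' : closedBall (F ζ + z) ρ ⊆ Eᶜ := by
        intro x hx
        apply hRE
        have : x - F ζ ∈ closedBall (0 : ℂ) R := hsub (by
          rw [mem_closedBall_iff_norm] at hx ⊢
          rwa [show x - F ζ - z = x - (F ζ + z) by ring])
        rwa [mem_closedBall_zero_iff, ← mem_closedBall_iff_norm] at this
      rw [hK.harm _ (hsub' (mem_closedBall_self hρ.le)) ρ hρ hsub']
      simp only [circleAverage_def, circleMap, smul_eq_mul, one_div, add_assoc])
  have hGF : AnalyticAt ℂ (fun x ↦ G (F x - F ζ)) ζ := by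
    refine AnalyticAt.fun_comp (g := G) ?_ (hF.sub analyticAt_const)
    exact hG _ (by simpa using hR)
  refine (InnerProductSpace.harmonicAt_congr_nhds ?_).2 hGF.harmonicAt_re
  have : ∀ᶠ x in nhds ζ, F x ∈ ball (F ζ) R := hF.continuousAt (ball_mem_nhds _ hR)
  filter_upwards [this] with x hx
  rw [← hGu _ (by rwa [mem_ball_zero_iff, ← mem_ball_iff_norm])]
  simp

theorem ClassK.nonneg {u : ℂ → ℝ} {E : Set ℂ} (hK : ClassK u E) (z : ℂ) : 0 ≤ u z := by
  by_cases h : z ∈ E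
  · exact (hK.vanish z h).ge
  · exact (hK.pos z h).le

theorem ClassK.sq_notMem {u : ℂ → ℝ} {E : Set ℂ} (hK : ClassK u E) {w : ℂ} (hw : 0 < w.re) :
    w ^ 2 ∉ E := by
  intro h
  obtain ⟨h1, h2⟩ := hK.subNegAxis h
  simp only [sq, Complex.mul_im, Complex.mul_re] at h1 h2
  have h3 : w.im = 0 := by
    have : w.re * w.im = 0 := by linarith
    exact (mul_eq_zero.1 this).resolve_left hw.ne'
  rw [h3] at h2
  nlinarith

theorem norm_sub_lt_norm_add {a : ℝ} (ha : 0 < a) {w : ℂ} (hw : 0 < w.re) :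
    ‖w - a‖ < ‖w + a‖ := by
  rw [← sq_lt_sq₀ (norm_nonneg _) (norm_nonneg _)]
  simp only [Complex.sq_norm, Complex.normSq_apply, Complex.sub_re, Complex.sub_im,
    Complex.add_re, Complex.add_im, Complex.ofReal_re, Complex.ofReal_im]
  nlinarith [mul_pos ha hw]

/-- Harnack's inequality transported to the slit plane by `ζ ↦ (a (1 + ζ) / (1 - ζ)) ^ 2`. -/
theorem ClassK.harnack {u : ℂ → ℝ} {E : Set ℂ} (hK : ClassK u E) {a : ℝ} (ha : 0 < a) {w : ℂ}
    (hw : 0 < w.re) :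
    u (w ^ 2) ≤ u ((a : ℂ) ^ 2) * ((‖w + a‖ + ‖w - a‖) / (‖w + a‖ - ‖w - a‖)) := by
  have ha' : (a : ℂ) ≠ 0 := by exact_mod_cast ha.ne'
  have hlt := norm_sub_lt_norm_add ha hw
  have hpos : 0 < ‖w + a‖ := (norm_nonneg _).trans_lt hlt
  have hne : w + a ≠ 0 := norm_pos_iff.1 hpos
  have hsub : ∀ ζ ∈ ball (0 : ℂ) 1, 1 - ζ ≠ 0 := by
    intro ζ hζ h
    rw [← sub_eq_zero.1 h] at hζ
    simp at hζ
  have hre : ∀ ζ ∈ ball (0 : ℂ) 1, 0 < (a * ((1 + ζ) / (1 - ζ)) : ℂ).re := by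
    intro ζ hζ
    have h1 : 0 < Complex.normSq (1 - ζ) := Complex.normSq_pos.2 (hsub ζ hζ)
    have h2 : ‖ζ‖ ^ 2 < 1 := by
      have : ‖ζ‖ < 1 := by simpa using hζ
      nlinarith [norm_nonneg ζ]
    rw [Complex.re_ofReal_mul, Complex.div_re, ← add_div]
    refine mul_pos ha (div_pos ?_ h1)
    simp only [Complex.sq_norm, Complex.normSq_apply] at h2
    simp only [Complex.add_re, Complex.sub_re, Complex.add_im, Complex.sub_im, Complex.one_re,
      Complex.one_im]
    linarith
  have hk : ‖(w - a) / (w + a)‖ < 1 := by rwa [norm_div, div_lt_one hpos]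
  have h := harnack_unitDisc (g := fun ζ ↦ u ((a * ((1 + ζ) / (1 - ζ))) ^ 2))
    (fun ζ hζ ↦ hK.harmonicAt_comp
      (F := fun ζ ↦ (a * ((1 + ζ) / (1 - ζ))) ^ 2)
      ((analyticAt_const.mul ((analyticAt_const.add analyticAt_id).div
        (analyticAt_const.sub analyticAt_id) (hsub ζ hζ))).pow 2) (hK.sq_notMem (hre ζ hζ)))
    (fun ζ _ ↦ hK.nonneg _) hk
  have e1 : a * ((1 + (w - a) / (w + a)) / (1 - (w - a) / (w + a))) = w := by
    have h₁ : 1 + (w - a) / (w + a) = 2 * w / (w + a) := by field_simp; ring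
    have h₂ : 1 - (w - a) / (w + a) = 2 * a / (w + a) := by field_simp; ring
    rw [h₁, h₂]
    field_simp
  have e2 : (1 + ‖(w - a) / (w + a)‖) / (1 - ‖(w - a) / (w + a)‖) =
      (‖w + a‖ + ‖w - a‖) / (‖w + a‖ - ‖w - a‖) := by
    rw [norm_div]
    have : ‖w + a‖ - ‖w - a‖ ≠ 0 := by linarith
    have : 1 - ‖w - a‖ / ‖w + a‖ ≠ 0 := by
      rw [norm_div] at hk; linarith
    field_simp
  rw [e2] at h
  simpa [e1] using h

theorem ClassK.apply_le_mul_sqrt_div {u : ℂ → ℝ} {E : Set ℂ} (hK : ClassK u E) {r s : ℝ}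
    (hr : 0 < r) (hrs : r ≤ s) : u s ≤ u r * (√s / √r) := by
  have hs : 0 < s := hr.trans_le hrs
  have h := hK.harnack (sqrt_pos.2 hr) (w := √s) (by simpa using hs)
  have hle := sqrt_le_sqrt hrs
  have h0 := sqrt_pos.2 hr
  rw [← Complex.ofReal_pow, ← Complex.ofReal_pow, sq_sqrt hs.le, sq_sqrt hr.le,
    ← Complex.ofReal_add, ← Complex.ofReal_sub, Complex.norm_real, Complex.norm_real,
    norm_of_nonneg (by linarith), norm_of_nonneg (by linarith)] at h
  rwa [show √s + √r + (√s - √r) = 2 * √s by ring,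
    show √s + √r - (√s - √r) = 2 * √r by ring, mul_div_mul_left _ _ two_ne_zero] at h

theorem ClassK.apply_mul_abs_im_le {u : ℂ → ℝ} {E : Set ℂ} (hK : ClassK u E) (z : ℂ) :
    u z * |z.im| ≤ 8 * ‖z‖ * u (‖z‖ : ℝ) := by
  rcases eq_or_ne z.im 0 with h0 | h0
  · rw [h0, abs_zero, mul_zero]
    have := hK.nonneg (‖z‖ : ℝ)
    positivity
  obtain ⟨w, hw, hwz⟩ : ∃ w : ℂ, 0 < w.re ∧ w ^ 2 = z := by
    obtain ⟨w, hw⟩ := IsAlgClosed.exists_pow_nat_eq z two_pos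
    have : w.re ≠ 0 := by
      rintro h
      rw [← hw] at h0
      simp [sq, h] at h0
    rcases this.lt_or_gt with h | h
    · exact ⟨-w, by simpa using h, by simpa using hw⟩
    · exact ⟨w, h, hw⟩
  have hz0 : ‖w‖ ^ 2 = ‖z‖ := by rw [← hwz, norm_pow]
  set a := ‖w‖ with hadef
  have ha : 0 < a := norm_pos_iff.2 (by rintro rfl; simp at hw)
  have h := hK.harnack ha hw
  have hlt := norm_sub_lt_norm_add ha hw
  rw [hwz, ← Complex.ofReal_pow, hz0] at h
  have hA : ‖w + a‖ ≤ 2 * a := by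
    refine (norm_add_le _ _).trans ?_
    simp [← hadef, abs_of_pos ha, two_mul]
  have hprod : (‖w + a‖ + ‖w - a‖) * (‖w + a‖ - ‖w - a‖) = 4 * a * w.re := by
    have e : ‖w + a‖ ^ 2 - ‖w - a‖ ^ 2 = 4 * a * w.re := by
      simp only [Complex.sq_norm, Complex.normSq_apply, Complex.sub_re, Complex.sub_im,
        Complex.add_re, Complex.add_im, Complex.ofReal_re, Complex.ofReal_im]
      ring
    linarith
  have him : |z.im| ≤ 2 * w.re * a := by
    have e : z.im = 2 * w.re * w.im := by
      rw [← hwz, sq, Complex.mul_im]; ring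
    rw [e, abs_mul, abs_of_pos (by positivity)]
    exact mul_le_mul_of_nonneg_left (Complex.abs_im_le_norm w) (by positivity)
  have hfrac : (‖w + a‖ + ‖w - a‖) / (‖w + a‖ - ‖w - a‖) * |z.im| ≤ 8 * ‖z‖ := by
    rw [div_mul_eq_mul_div, div_le_iff₀ (by linarith)]
    have hS : 0 < ‖w + a‖ + ‖w - a‖ := by linarith [norm_nonneg (w - a)]
    have hS4 : ‖w + a‖ + ‖w - a‖ ≤ 4 * a := by linarith
    refine le_of_mul_le_mul_left ?_ hS
    calc _ ≤ 4 * a * (4 * a * (2 * w.re * a)) := by gcongr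
      _ = 8 * a ^ 2 * (4 * a * w.re) := by ring
      _ = _ := by rw [← hprod, hz0]; ring
  calc u z * |z.im| ≤ _ * |z.im| := mul_le_mul_of_nonneg_right h (abs_nonneg _)
    _ = u (‖z‖ : ℝ) * ((‖w + a‖ + ‖w - a‖) / (‖w + a‖ - ‖w - a‖) * |z.im|) := by ring
    _ ≤ u (‖z‖ : ℝ) * (8 * ‖z‖) := mul_le_mul_of_nonneg_left hfrac (hK.nonneg _)
    _ = _ := by ring

theorem circleAverage_im_sq (a : ℂ) (ρ : ℝ) :
    circleAverage (fun z ↦ z.im ^ 2) a ρ = a.im ^ 2 + ρ ^ 2 / 2 := by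
  have e : (fun z : ℂ ↦ z.im ^ 2) = fun z ↦ (1 / 2 : ℝ) • (‖z‖ ^ 2 - (z ^ 2).re) := by
    funext z
    simp only [Complex.sq_norm, Complex.normSq_apply, pow_two z, Complex.mul_re, smul_eq_mul]
    ring
  rw [e, circleAverage_fun_smul, circleAverage_fun_sub
    (by apply ContinuousOn.circleIntegrable'; fun_prop)
    (by apply ContinuousOn.circleIntegrable'; fun_prop), circleAverage_norm_sq,
    InnerProductSpace.HarmonicOnNhd.circleAverage_eq (f := fun z : ℂ ↦ (z ^ 2).re)
      (fun z _ ↦ AnalyticAt.harmonicAt_re (by fun_prop))]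
  simp only [Complex.sq_norm, Complex.normSq_apply, pow_two a, Complex.mul_re, smul_eq_mul]
  ring

/-- A subharmonic function bounded by `K / |Im z|` on a disc is locally bounded in terms of `K`. -/
theorem apply_mul_sub_norm_le {u : ℂ → ℝ} {R K : ℝ} (hu : Continuous u) (hu0 : ∀ z, 0 ≤ u z)
    (hm : ∀ z : ℂ, ∀ ρ > 0, u z ≤ circleAverage u z ρ)
    (hK : ∀ z ∈ closedBall (0 : ℂ) R, u z * |z.im| ≤ K) {z : ℂ} (hz : z ∈ closedBall 0 R) :
    u z * (R - ‖z‖) ≤ 7704 * K := by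
  have hK0 : 0 ≤ K := (mul_nonneg (hu0 z) (abs_nonneg _)).trans (hK z hz)
  obtain ⟨a, ha, hmax⟩ := (isCompact_closedBall (0 : ℂ) R).exists_isMaxOn ⟨z, hz⟩
    (f := fun z ↦ u z * (R - ‖z‖)) (by fun_prop)
  refine (hmax hz).trans ?_
  simp only
  have haR : ‖a‖ ≤ R := by simpa using ha
  rcases haR.eq_or_lt with h | h
  · rw [h, sub_self, mul_zero]; positivity
  set s := (R - ‖a‖) / 72 with hs
  have hs0 : 0 < s := by apply div_pos <;> linarith
  have hd : R - ‖a‖ = 72 * s := by rw [hs]; ring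
  rw [hd]
  have hball : ∀ x ∈ sphere a |s|, ‖x‖ ≤ ‖a‖ + s := by
    intro x hx
    rw [abs_of_pos hs0, mem_sphere_iff_norm] at hx
    linarith [norm_le_norm_add_norm_sub a x, norm_sub_rev a x]
  have hmem : ∀ x ∈ sphere a |s|, x ∈ closedBall (0 : ℂ) R := by
    intro x hx
    rw [mem_closedBall_zero_iff]
    linarith [hball x hx]
  have hub : ∀ x ∈ sphere a |s|, u x ≤ 72 / 71 * u a := by
    intro x hx
    have h1 : u x * (R - ‖x‖) ≤ u a * (R - ‖a‖) := hmax (hmem x hx)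
    have h2 : u x * (71 * s) ≤ u x * (R - ‖x‖) :=
      mul_le_mul_of_nonneg_left (by linarith [hball x hx]) (hu0 x)
    rw [hd] at h1
    refine le_of_mul_le_mul_right ?_ hs0
    linarith
  have him : ∀ x ∈ sphere a |s|, |x.im - a.im| ≤ s := by
    intro x hx
    rw [abs_of_pos hs0, mem_sphere_iff_norm] at hx
    rw [← hx, ← Complex.sub_im]
    exact Complex.abs_im_le_norm _
  have hB := hm a s hs0
  rcases lt_or_ge (2 * s) |a.im| with hc | hc
  · have : circleAverage u a s ≤ K / s := by
      refine circleAverage_mono_on_of_le_circle hu.continuousOn.circleIntegrable' fun x hx ↦ ?_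
      rw [le_div_iff₀ hs0]
      refine (mul_le_mul_of_nonneg_left ?_ (hu0 x)).trans (hK x (hmem x hx))
      linarith [him x hx, abs_sub_abs_le_abs_sub a.im x.im, abs_sub_comm a.im x.im]
    have h2 := hB.trans this
    rw [le_div_iff₀ hs0] at h2
    linarith
  · set b := 72 / 71 * u a with hb
    have hb0 : 0 ≤ b := mul_nonneg (by norm_num) (hu0 a)
    have hpt : ∀ x ∈ sphere a |s|,
        u x ≤ (3 * K / s + b * (73 / 72)) - (b / (9 * s ^ 2)) • x.im ^ 2 := by
      intro x hx
      have e : (b / (9 * s ^ 2)) • x.im ^ 2 = b * (x.im ^ 2 / (9 * s ^ 2)) := by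
        rw [smul_eq_mul]; ring
      rw [e]
      rcases lt_or_ge |x.im| (s / 3) with ht | ht
      · have h1 : x.im ^ 2 / (9 * s ^ 2) ≤ 1 / 72 := by
          rw [div_le_iff₀ (by positivity), ← sq_abs]
          nlinarith [abs_nonneg x.im]
        have h2 : 0 ≤ 3 * K / s := by positivity
        linarith [hub x hx, mul_le_mul_of_nonneg_left h1 hb0]
      · have h1 : x.im ^ 2 / (9 * s ^ 2) ≤ 1 := by
          rw [div_le_iff₀ (by positivity), ← sq_abs]
          have : |x.im| ≤ 3 * s := by
            linarith [him x hx, abs_sub_abs_le_abs_sub x.im a.im]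
          nlinarith [abs_nonneg x.im]
        have h2 : u x ≤ 3 * K / s := by
          rw [le_div_iff₀ hs0]
          have := mul_le_mul_of_nonneg_left ht (hu0 x)
          linarith [hK x (hmem x hx)]
        linarith [mul_le_mul_of_nonneg_left h1 hb0]
    have hint : CircleIntegrable (fun x : ℂ ↦ (b / (9 * s ^ 2)) • x.im ^ 2) a s := by
      apply ContinuousOn.circleIntegrable'; fun_prop
    have havg := circleAverage_mono hu.continuousOn.circleIntegrable'
      ((circleIntegrable_const _ _ _).sub hint) hpt
    rw [circleAverage_sub (circleIntegrable_const _ _ _) hint, circleAverage_const,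
      circleAverage_fun_smul, circleAverage_im_sq, smul_eq_mul] at havg
    have h3 : b / 18 ≤ b / (9 * s ^ 2) * (a.im ^ 2 + s ^ 2 / 2) := by
      rw [div_mul_eq_mul_div, div_le_div_iff₀ (by norm_num) (by positivity)]
      nlinarith [mul_nonneg hb0 (sq_nonneg a.im)]
    have h4 : u a * (2 / 213) ≤ K / s := by
      have : 3 * K / s = 3 * (K / s) := by ring
      linarith
    rw [le_div_iff₀ hs0] at h4
    linarith

theorem ClassK.exists_le_mul_sqrt {u : ℂ → ℝ} {E : Set ℂ} (hK : ClassK u E) :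
    ∃ C > 0, ∀ z : ℂ, 1 ≤ ‖z‖ → u z ≤ C * √‖z‖ := by
  obtain ⟨M, hM⟩ := (isCompact_closedBall (0 : ℂ) 1).bddAbove_image hK.cont.continuousOn
  have hM' : ∀ z : ℂ, ‖z‖ ≤ 1 → u z ≤ M :=
    fun z hz ↦ hM (Set.mem_image_of_mem u (by simpa using hz))
  have hM0 : 0 ≤ M := (hK.nonneg 0).trans (hM' 0 (by simp))
  have h1 := hK.nonneg 1
  have hsub : ∀ z : ℂ, ∀ ρ > 0, u z ≤ circleAverage u z ρ := by
    intro z ρ hρ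
    refine (hK.submean z ρ hρ).trans_eq ?_
    simp only [circleAverage_def, circleMap, smul_eq_mul, one_div]
  set L := 8 * u 1 + M with hL
  have hbound : ∀ R : ℝ, 1 ≤ R → ∀ z ∈ closedBall (0 : ℂ) R, u z * |z.im| ≤ L * (R * √R) := by
    intro R hR z hz
    have hzR : ‖z‖ ≤ R := by simpa using hz
    have hRR : 1 ≤ R * √R := one_le_mul_of_one_le_of_one_le hR (one_le_sqrt.2 hR)
    rcases le_total ‖z‖ 1 with h | h
    · calc u z * |z.im| ≤ M * 1 := by
            gcongr
            · exact hM' z h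
            · exact (Complex.abs_im_le_norm z).trans h
        _ ≤ L * (R * √R) := by gcongr; linarith
    · have h2 := hK.apply_le_mul_sqrt_div one_pos h
      rw [sqrt_one, div_one, Complex.ofReal_one] at h2
      calc u z * |z.im| ≤ 8 * ‖z‖ * u (‖z‖ : ℝ) := hK.apply_mul_abs_im_le z
        _ ≤ 8 * R * (u 1 * √R) := by
            have := h2.trans (mul_le_mul_of_nonneg_left (sqrt_le_sqrt hzR) h1)
            have h3 := hK.nonneg (‖z‖ : ℝ)
            gcongr
        _ = 8 * u 1 * (R * √R) := by ring
        _ ≤ L * (R * √R) := by gcongr; linarith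
  refine ⟨7704 * 4 * (L + 1), by positivity, fun z hz ↦ ?_⟩
  have h := apply_mul_sub_norm_le (R := 2 * ‖z‖) hK.cont hK.nonneg hsub
    (hbound _ (by linarith)) (z := z) (by simp; linarith [norm_nonneg z])
  have hs : √(2 * ‖z‖) ≤ 2 * √‖z‖ := by
    rw [sqrt_le_left (by positivity), mul_pow, sq_sqrt (norm_nonneg z)]
    linarith
  have h2 : u z * ‖z‖ ≤ 7704 * 4 * (L + 1) * √‖z‖ * ‖z‖ := by
    calc u z * ‖z‖ = u z * (2 * ‖z‖ - ‖z‖) := by ring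
      _ ≤ _ := h
      _ ≤ 7704 * ((L + 1) * (2 * ‖z‖ * (2 * √‖z‖))) := by
          gcongr
          linarith
      _ = _ := by ring
  exact le_of_mul_le_mul_right h2 (by linarith)

theorem stmt13 (u : ℂ → ℝ) (E : Set ℂ) (hK : ClassK u E) :
    (∀ ⦃r s : ℝ⦄, 0 < r → r ≤ s →
      u ((s : ℝ) : ℂ) / s ^ ((1:ℝ)/2) ≤ u ((r : ℝ) : ℂ) / r ^ ((1:ℝ)/2)) ∧
    limsup (fun r => Real.log (Bmax u r) / Real.log r) atTop ≤ 1 / 2 := by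
  refine ⟨fun r s hr hrs ↦ ?_, ?_⟩
  · rw [← sqrt_eq_rpow, ← sqrt_eq_rpow, div_le_iff₀ (sqrt_pos.2 (hr.trans_le hrs))]
    refine (hK.apply_le_mul_sqrt_div hr hrs).trans_eq ?_
    ring
  obtain ⟨C, hC, hCu⟩ := hK.exists_le_mul_sqrt
  have hB : ∀ r : ℝ, 1 < r →
      Real.log (Bmax u r) / Real.log r ≤ Real.log C / Real.log r + 1 / 2 := by
    intro r hr
    have hr0 : 0 < r := by linarith
    have hlog : 0 < Real.log r := Real.log_pos hr
    have hle : ∀ x ∈ u '' sphere (0 : ℂ) r, x ≤ C * √r := by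
      rintro _ ⟨z, hz, rfl⟩
      have hz' : ‖z‖ = r := by simpa using hz
      rw [← hz']
      exact hCu z (by linarith)
    have hmem : u r ∈ u '' sphere (0 : ℂ) r :=
      Set.mem_image_of_mem u (by simp [abs_of_pos hr0])
    have hpos : 0 < u r := hK.pos _ fun h ↦ by
      have := (hK.subNegAxis h).2
      simp at this
      linarith
    have h1 : 0 < Bmax u r := hpos.trans_le (le_csSup ⟨_, hle⟩ hmem)
    have h2 : Bmax u r ≤ C * √r := csSup_le ⟨_, hmem⟩ hle
    have h3 := Real.log_le_log h1 h2
    rw [Real.log_mul hC.ne' (sqrt_pos.2 hr0).ne', Real.log_sqrt hr0.le] at h3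
    rw [div_add' _ _ _ hlog.ne', div_le_div_iff_of_pos_right hlog]
    linarith
  have hlim : Tendsto (fun r ↦ Real.log C / Real.log r + 1 / 2) atTop (nhds (0 + 1 / 2)) :=
    (Real.tendsto_log_atTop.const_div_atTop _).add_const _
  rw [limsup_eq]
  by_cases hbdd : BddBelow {a | ∀ᶠ r in atTop, Real.log (Bmax u r) / Real.log r ≤ a}
  · refine le_of_forall_pos_le_add fun ε hε ↦ csInf_le hbdd ?_
    filter_upwards [hlim.eventually_le_const (u := 1 / 2 + ε) (by linarith),
      eventually_gt_atTop 1] with r h1 h2 using (hB r h2).trans h1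
  · rw [Real.sInf_of_not_bddBelow hbdd]
    norm_num
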